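/- Let R be a commutative noetherian ring and let φ be an sp-filtration of Spec R satisfying the weak Cousin condition. Then the map F(φ) : Spec R → ℤ ∪ {±∞} defined by F(φ)(p) = sup{i + 1 : i ∈ ℤ, p ∈ φ(i)} (supremum of the empty set being −∞) is a t-function on Spec R. -/

import Mathlib

open CategoryTheory

universe w u

noncomputable section

/-- A subset `W` of `Spec R` is specialization-closed if `V(p) ⊆ W` for every `p ∈ W`. -/
def SpecializationClosed {R : Type u} [CommRing R] (W : Set (PrimeSpectrum R)) : Prop :=
  ∀ p ∈ W, PrimeSpectrum.zeroLocus (p.asIdeal : Set R) ⊆ W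

section Filtrations

variable {R : Type u} [CommRing R]

/-- An sp-filtration of `Spec R`: a decreasing sequence of specialization-closed subsets. -/
def IsSPFiltration (φ : ℤ → Set (PrimeSpectrum R)) : Prop :=
  (∀ i : ℤ, SpecializationClosed (φ i)) ∧ ∀ i : ℤ, φ (i + 1) ⊆ φ i

/-- An sp-filtration satisfies the weak Cousin condition if for every integer `i` and every
saturated inclusion `p ⊊ q` of primes, `q ∈ φ(i)` implies `p ∈ φ(i-1)`. -/
def SatisfiesWeakCousin (φ : ℤ → Set (PrimeSpectrum R)) : Prop :=
  ∀ i : ℤ, ∀ p q : PrimeSpectrum R, p ⋖ q → q ∈ φ i → p ∈ φ (i - 1)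

/-- The map `F`, sending a filtration `φ` to the function
`p ↦ sup {i + 1 : i ∈ ℤ, p ∈ φ(i)}` with values in `ℤ ∪ {±∞}`
(the supremum of the empty set being `-∞`). -/
def filtToFun (φ : ℤ → Set (PrimeSpectrum R)) (p : PrimeSpectrum R) : WithTop (WithBot ℤ) :=
  sSup ((fun i : ℤ => (((i + 1 : ℤ) : WithBot ℤ) : WithTop (WithBot ℤ))) '' {i : ℤ | p ∈ φ i})

/-- The map `Φ`, sending a function `f : Spec R → ℤ ∪ {±∞}` to the filtration
`i ↦ {p ∈ Spec R : f(p) > i}`. -/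
def funToFilt (f : PrimeSpectrum R → WithTop (WithBot ℤ)) (i : ℤ) : Set (PrimeSpectrum R) :=
  {p | (((i : ℤ) : WithBot ℤ) : WithTop (WithBot ℤ)) < f p}

end Filtrations

/-- The depth of a module `N` over a noetherian local ring `A`, defined as
`inf { i | Ext_A^i(k, N) ≠ 0 }` where `k` is the residue field of `A`
(the infimum of the empty set being `∞`). -/
def moduleDepth (A : Type u) [CommRing A] [IsLocalRing A]
    (N : Type u) [AddCommGroup N] [Module A N] : ℕ∞ :=
  sInf {i : ℕ∞ | ∃ m : ℕ, i = m ∧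
    Nontrivial (((Ext A (ModuleCat.{u} A) m).obj
      (Opposite.op (ModuleCat.of A (IsLocalRing.ResidueField A)))).obj (ModuleCat.of A N))}

/-- `height (p/q)`: the supremum of the lengths of chains of primes between `q` and `p`. -/
def relHeight {R : Type u} [CommRing R] (q p : PrimeSpectrum R) : ℕ∞ :=
  ⨆ (c : LTSeries (PrimeSpectrum R)) (_ : c.head = q ∧ c.last = p), (c.length : ℕ∞)

/-- The depth of the localized module `M_q` over the local ring `R_q`. -/
def localizedDepth {R : Type u} [CommRing R] (q : PrimeSpectrum R)
    (M : Type u) [AddCommGroup M] [Module R M] : ℕ∞ :=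
  moduleDepth (Localization.AtPrime q.asIdeal) (LocalizedModule q.asIdeal.primeCompl M)

/-- The canonical embedding of `ℕ ∪ {∞}` into `ℤ ∪ {∞}`. -/
def enatToWithTopInt : ℕ∞ → WithTop ℤ := WithTop.map (Nat.cast : ℕ → ℤ)

/-- The canonical embedding of `ℕ ∪ {∞}` into `ℤ ∪ {±∞}`. -/
def enatToE : ℕ∞ → WithTop (WithBot ℤ) := WithTop.map (fun m : ℕ => (m : WithBot ℤ))

/-- A `t`-function on `Spec R`: a map `f : Spec R → ℤ ∪ {±∞}` such that
`f(p) ≤ f(q) ≤ f(p) + height (q/p)` for all inclusions `p ⊆ q` of primes. -/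
def IsTFunction {R : Type u} [CommRing R] (f : PrimeSpectrum R → WithTop (WithBot ℤ)) : Prop :=
  ∀ p q : PrimeSpectrum R, p ≤ q → f p ≤ f q ∧ f q ≤ f p + enatToE (relHeight p q)

section

variable {R : Type u} [CommRing R]

theorem IsSPFiltration.antitone {φ : ℤ → Set (PrimeSpectrum R)} (hφ : IsSPFiltration φ) :
    Antitone φ :=
  antitone_int_of_succ_le hφ.2

theorem IsSPFiltration.mem_of_le {φ : ℤ → Set (PrimeSpectrum R)} (hφ : IsSPFiltration φ) {i : ℤ}
    {p q : PrimeSpectrum R} (hpq : p ≤ q) (hp : p ∈ φ i) : q ∈ φ i :=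
  hφ.1 i p hp hpq

theorem length_le_relHeight (c : LTSeries (PrimeSpectrum R)) :
    (c.length : ℕ∞) ≤ relHeight c.head c.last :=
  le_iSup₂_of_le c ⟨rfl, rfl⟩ le_rfl

theorem relHeight_add_one_le {p q r : PrimeSpectrum R} (hpq : p ≤ q) (hqr : q < r) :
    relHeight p q + 1 ≤ relHeight p r := by
  have hone : 1 ≤ relHeight p r :=
    le_iSup₂_of_le (LTSeries.mk 1 ![p, r] (Fin.strictMono_iff_lt_succ.2 (by
      simpa using hpq.trans_lt hqr))) ⟨rfl, rfl⟩ (by simp)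
  have : Nonempty (LTSeries (PrimeSpectrum R)) := ⟨RelSeries.singleton _ p⟩
  rw [relHeight, ENat.iSup_add]
  refine iSup_le fun c ↦ ?_
  by_cases hc : c.head = p ∧ c.last = q
  · obtain ⟨rfl, rfl⟩ := hc
    simpa using length_le_relHeight (c.snoc r hqr)
  · simpa [hc] using hone

instance [IsNoetherianRing R] : WellFoundedGT (PrimeSpectrum R) :=
  StrictMono.wellFoundedGT (f := PrimeSpectrum.asIdeal) fun _ _ h ↦ h

theorem SatisfiesWeakCousin.mem_sub_of_relHeight_le [IsNoetherianRing R]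
    {φ : ℤ → Set (PrimeSpectrum R)} (hwc : SatisfiesWeakCousin φ) (hφ : IsSPFiltration φ)
    {n : ℕ} {p q : PrimeSpectrum R} (hpq : p ≤ q) (hn : relHeight p q ≤ n) {i : ℤ}
    (hq : q ∈ φ i) : p ∈ φ (i - n) := by
  induction n generalizing q i with
  | zero =>
    obtain rfl | hlt := hpq.eq_or_lt
    · simpa using hq
    · have := (relHeight_add_one_le le_rfl hlt).trans hn
      simp at this
  | succ n ih =>
    obtain rfl | hlt := hpq.eq_or_lt
    · exact hφ.antitone (by lia) hq
    · obtain ⟨r, hpr, hrq⟩ := exists_le_covBy_of_lt hlt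
      have hle := (relHeight_add_one_le hpr hrq.lt).trans hn
      rw [Nat.cast_add, Nat.cast_one, ENat.add_le_add_iff_right ENat.one_ne_top] at hle
      have := ih hpr hle (hwc i r q hrq hq)
      rwa [sub_sub, add_comm 1, ← Nat.cast_succ] at this

theorem le_filtToFun {φ : ℤ → Set (PrimeSpectrum R)} {p : PrimeSpectrum R} {i : ℤ}
    (hp : p ∈ φ i) : (((i + 1 : ℤ) : WithBot ℤ) : WithTop (WithBot ℤ)) ≤ filtToFun φ p :=
  le_sSup ⟨i, hp, rfl⟩

theorem filtToFun_le {φ : ℤ → Set (PrimeSpectrum R)} {p : PrimeSpectrum R}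
    {a : WithTop (WithBot ℤ)}
    (h : ∀ i, p ∈ φ i → (((i + 1 : ℤ) : WithBot ℤ) : WithTop (WithBot ℤ)) ≤ a) :
    filtToFun φ p ≤ a :=
  sSup_le (by rintro _ ⟨i, hi, rfl⟩; exact h i hi)

end

/-- If `φ` is an sp-filtration of `Spec R` satisfying the weak Cousin condition, then
`F(φ) : p ↦ sup {i + 1 : p ∈ φ(i)}` is a `t`-function on `Spec R`. -/
theorem filtToFun_isTFunction_of_weakCousin
    (R : Type u) [CommRing R] [IsNoetherianRing R]
    (φ : ℤ → Set (PrimeSpectrum R)) (hφ : IsSPFiltration φ)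
    (hwc : SatisfiesWeakCousin φ) :
    IsTFunction (filtToFun φ) := by
  intro p q hpq
  refine ⟨filtToFun_le fun i hp ↦ le_filtToFun (hφ.mem_of_le hpq hp), ?_⟩
  cases h : relHeight p q with
  | top => exact le_top.trans_eq (WithTop.add_top _).symm
  | coe n =>
    refine filtToFun_le fun i hq ↦ ?_
    have hp := le_filtToFun (hwc.mem_sub_of_relHeight_le hφ hpq h.le hq)
    calc (((i + 1 : ℤ) : WithBot ℤ) : WithTop (WithBot ℤ))
        = (((i - n + 1 : ℤ) : WithBot ℤ) : WithTop (WithBot ℤ)) + enatToE n := by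
          change _ = (((i - n + 1 : ℤ) : WithBot ℤ) : WithTop (WithBot ℤ)) +
            (((n : ℤ) : WithBot ℤ) : WithTop (WithBot ℤ))
          rw [← WithTop.coe_add, ← WithBot.coe_add]
          congr 2
          ring
      _ ≤ _ := by gcongr
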